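/- arXiv:2604.02184 — 4 statements merged into one kernel-verified Lean document; each statement's English description precedes it below -/
import Mathlib

section
/- Fix reals L_min < L_max and angles 0 < α_min < α_max < π. Let β(p) = α_max + ((α_min − α_max)/(L_max − L_min))(p − L_min) and let u : [L_min, L_max] → ℝ be continuous with u(p) > 0 for all p. Define the reflector curve r(p) = (p + u(p)·cos β(p), u(p)·sin β(p)) ∈ ℝ². Then for every s ∈ [L_min, L_max] and every α ∈ [α_min, α_max] there exist p* ∈ [L_min, L_max] and λ > 0 such that r(p*) = (s, 0) + λ·(cos α, sin α); i.e., every ray emitted from the source segment at an angle in [α_min, α_max] intersects the reflector curve. -/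
open Real Set

/-- Every ray emitted from the source segment at an angle in `[αmin, αmax]`
intersects the reflector curve. -/
theorem ray_intersection_guarantee
    (Lmin Lmax αmin αmax : ℝ) (hL : Lmin < Lmax)
    (hα0 : 0 < αmin) (hαα : αmin < αmax) (hαπ : αmax < Real.pi)
    (β : ℝ → ℝ)
    (hβ : ∀ p, β p = αmax + ((αmin - αmax) / (Lmax - Lmin)) * (p - Lmin))
    (u : ℝ → ℝ) (hu_cont : ContinuousOn u (Icc Lmin Lmax))
    (hu_pos : ∀ p ∈ Icc Lmin Lmax, 0 < u p)
    (r : ℝ → ℝ × ℝ)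
    (hr : ∀ p, r p = (p + u p * Real.cos (β p), u p * Real.sin (β p)))
    (s : ℝ) (hs : s ∈ Icc Lmin Lmax)
    (α : ℝ) (hα : α ∈ Icc αmin αmax) :
    ∃ pstar ∈ Icc Lmin Lmax, ∃ lam : ℝ, 0 < lam ∧
      r pstar = (s + lam * Real.cos α, lam * Real.sin α) := by
  have hsα : 0 < sin α := sin_pos_of_pos_of_lt_pi (hα0.trans_le hα.1) (hα.2.trans_lt hαπ)
  have hL' : Lmax - Lmin ≠ 0 := (sub_pos.2 hL).ne'
  have hβmin : β Lmin = αmax := by simp [hβ]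
  have hβmax : β Lmax = αmin := by rw [hβ, div_mul_cancel₀ _ hL']; ring
  have hβ_cont : Continuous β := by
    rw [funext hβ]
    fun_prop
  have hg_cont : ContinuousOn (fun p => u p * sin (β p - α) - sin α * (p - s))
      (Icc Lmin Lmax) := by
    fun_prop
  have hg_min : 0 ≤ u Lmin * sin (β Lmin - α) - sin α * (Lmin - s) := by
    rw [hβmin]
    have h1 : 0 ≤ sin (αmax - α) :=
      sin_nonneg_of_nonneg_of_le_pi (by linarith [hα.2]) (by linarith [hα.1])
    have h2 := mul_nonneg (hu_pos Lmin (left_mem_Icc.2 hL.le)).le h1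
    have h3 := mul_nonneg hsα.le (sub_nonneg.2 hs.1)
    linarith
  have hg_max : u Lmax * sin (β Lmax - α) - sin α * (Lmax - s) ≤ 0 := by
    rw [hβmax]
    have h1 : sin (αmin - α) ≤ 0 :=
      sin_nonpos_of_nonpos_of_neg_pi_le (by linarith [hα.1]) (by linarith [hα.2])
    have h2 := mul_nonpos_of_nonneg_of_nonpos
      (hu_pos Lmax (right_mem_Icc.2 hL.le)).le h1
    have h3 := mul_nonneg hsα.le (sub_nonneg.2 hs.2)
    linarith
  obtain ⟨p, hp, hgp⟩ := intermediate_value_Icc' hL.le hg_cont ⟨hg_max, hg_min⟩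
  have hβp : αmin ≤ β p ∧ β p ≤ αmax := by
    have ht0 : 0 ≤ (p - Lmin) / (Lmax - Lmin) :=
      div_nonneg (sub_nonneg.2 hp.1) (sub_pos.2 hL).le
    have ht1 : (p - Lmin) / (Lmax - Lmin) ≤ 1 :=
      (div_le_one (sub_pos.2 hL)).2 (by linarith [hp.2])
    have hβt : β p = αmax + (αmin - αmax) * ((p - Lmin) / (Lmax - Lmin)) := by
      rw [hβ]
      ring
    constructor <;> nlinarith
  have hsβ : 0 < sin (β p) :=
    sin_pos_of_pos_of_lt_pi (hα0.trans_le hβp.1) (hβp.2.trans_lt hαπ)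
  refine ⟨p, hp, u p * sin (β p) / sin α, by have := hu_pos p hp; positivity, ?_⟩
  simp only [sin_sub] at hgp
  rw [hr, Prod.mk.injEq]
  constructor
  · field_simp
    linarith
  · field_simp
end

section
/- Fix reals L_min < L_max and angles 0 < α_min < α_max < π, and let β : [L_min, L_max] → ℝ be continuous with values in [α_min, α_max]. Let u : [L_min, L_max] → ℝ be continuous with u(p) > 0 for all p. Then the family of viewing-angle functions γ_s^{(λ)}(p) := arg( ((p − s)/λ + u(p)·cos β(p)) + (u(p)·sin β(p))·i ) converges to β(p) uniformly in (s, p) ∈ [L_min, L_max] × [L_min, L_max] as λ → ∞. -/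
open Real Set Filter

/-- The viewing-angle functions `γ_s^{(λ)}(p) = atan2((u p)·sin β(p), (p−s)/λ + (u p)·cos β(p))`
converge to `β(p)` uniformly in `(s, p)` on the square `[Lmin, Lmax]²` as `λ → ∞`. -/
theorem viewing_angle_tendstoUniformly
    (Lmin Lmax αmin αmax : ℝ) (hL : Lmin < Lmax)
    (hα0 : 0 < αmin) (hαα : αmin < αmax) (hαπ : αmax < Real.pi)
    (β : ℝ → ℝ) (hβc : ContinuousOn β (Icc Lmin Lmax))
    (hβr : ∀ p ∈ Icc Lmin Lmax, β p ∈ Icc αmin αmax)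
    (u : ℝ → ℝ) (huc : ContinuousOn u (Icc Lmin Lmax))
    (hup : ∀ p ∈ Icc Lmin Lmax, 0 < u p) :
    TendstoUniformlyOn
      (fun (lam : ℝ) (sp : ℝ × ℝ) =>
        Complex.arg
          ((((sp.2 - sp.1) / lam + u sp.2 * Real.cos (β sp.2) : ℝ) : ℂ)
            + ((u sp.2 * Real.sin (β sp.2) : ℝ) : ℂ) * Complex.I))
      (fun sp => β sp.2) atTop (Icc Lmin Lmax ×ˢ Icc Lmin Lmax) := by
  let G : ℝ → ℝ × ℝ → ℝ := fun t sp =>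
    Complex.arg
      ((((sp.2 - sp.1) * t + u sp.2 * Real.cos (β sp.2) : ℝ) : ℂ)
        + ((u sp.2 * Real.sin (β sp.2) : ℝ) : ℂ) * Complex.I)
  have hG : ContinuousOn G.uncurry (univ ×ˢ (Icc Lmin Lmax ×ˢ Icc Lmin Lmax)) := by
    have hmaps : MapsTo (fun x : ℝ × ℝ × ℝ => x.2.2)
        (univ ×ˢ (Icc Lmin Lmax ×ˢ Icc Lmin Lmax)) (Icc Lmin Lmax) := fun x hx => hx.2.2
    have hproj : ContinuousOn (fun x : ℝ × ℝ × ℝ => x.2.2)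
        (univ ×ˢ (Icc Lmin Lmax ×ˢ Icc Lmin Lmax)) := by fun_prop
    have hβ' := hβc.comp hproj hmaps
    have hu' := huc.comp hproj hmaps
    simp only [Function.comp_def] at hβ' hu'
    refine ContinuousOn.comp (g := Complex.arg) (t := Complex.slitPlane)
      (fun z hz => (Complex.continuousAt_arg hz).continuousWithinAt) ?_ ?_
    · fun_prop
    · rintro ⟨t, s, p⟩ ⟨-, -, hp⟩
      obtain ⟨h₁, h₂⟩ := hβr p hp
      have him : 0 < u p * Real.sin (β p) :=
        mul_pos (hup p hp) (Real.sin_pos_of_pos_of_lt_pi (by linarith) (by linarith))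
      refine Complex.mem_slitPlane_iff.2 (Or.inr ?_)
      rw [Complex.add_im, Complex.ofReal_im, zero_add, Complex.im_ofReal_mul, Complex.I_im,
        mul_one]
      exact him.ne'
  have hG0 : ∀ sp ∈ Icc Lmin Lmax ×ˢ Icc Lmin Lmax, G 0 sp = β sp.2 := by
    rintro ⟨s, p⟩ ⟨-, hp⟩
    obtain ⟨h₁, h₂⟩ := hβr p hp
    have h := Complex.arg_mul_cos_add_sin_mul_I (hup p hp)
      (θ := β p) ⟨by linarith [Real.pi_pos], by linarith⟩
    simp only [G]
    refine Eq.trans (congrArg Complex.arg ?_) h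
    push_cast
    ring
  intro V hV
  obtain ⟨v, hv, hvV⟩ := (isCompact_Icc.prod isCompact_Icc).mem_uniformity_of_prod hG
    (mem_univ 0) (symm_le_uniformity hV)
  rw [nhdsWithin_univ] at hv
  filter_upwards [tendsto_inv_atTop_zero.eventually_mem hv] with lam hlam sp hsp
  have h := hvV _ hlam sp hsp
  rw [hG0 sp hsp] at h
  exact h
end

section
/- Fix reals L_min < L_max and angles 0 < α_min < α_max < π, let β : [L_min, L_max] → ℝ be continuous with values in [α_min, α_max], and let u : [L_min, L_max] → ℝ be continuous with u(p) > 0 for all p. For λ > 0 define r_λ(p) = (p + λ·u(p)·cos β(p), λ·u(p)·sin β(p)) ∈ ℝ². Then the unit incident direction (r_λ(p) − (s, 0)) / ‖r_λ(p) − (s, 0)‖ converges to (cos β(p), sin β(p)) uniformly in (s, p) ∈ [L_min, L_max] × [L_min, L_max] as λ → ∞. -/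
open Real Set Filter

/-- Adding a horizontal displacement `d` to `t • (c, s)`, with `(c, s)` a unit vector, changes the
Euclidean norm by at most `|d|`. -/
lemma abs_sqrt_sub_le_of_unit {c s t d : ℝ} (hcs : c ^ 2 + s ^ 2 = 1) (ht : 0 ≤ t) :
    |√((d + t * c) ^ 2 + (t * s) ^ 2) - t| ≤ |d| := by
  have hc : |c| ≤ 1 := abs_le_one_iff_mul_self_le_one.2 (by nlinarith [sq_nonneg s])
  have hexp : (d + t * c) ^ 2 + (t * s) ^ 2 = |d| ^ 2 + 2 * t * (c * d) + t ^ 2 := by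
    rw [sq_abs]
    linear_combination t ^ 2 * hcs
  have hcd : |c * d| ≤ |d| := by
    rw [abs_mul]
    exact mul_le_of_le_one_left (abs_nonneg d) hc
  obtain ⟨hlow, hupp⟩ := abs_le.1 hcd
  rw [hexp, abs_sub_le_iff]
  constructor
  · rw [sub_le_iff_le_add, Real.sqrt_le_left (by positivity)]
    nlinarith [mul_le_mul_of_nonneg_left hupp ht]
  · rw [sub_le_comm]
    apply Real.le_sqrt_of_sq_le
    nlinarith [mul_le_mul_of_nonneg_left hlow ht]

/-- If a vector of length `N` differs from `t • e` by `a` in one coordinate, where `|a| ≤ M` and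
`|N - t| ≤ M`, then normalizing moves that coordinate by less than `ε` once `t` is large. -/
lemma abs_inv_mul_sub_lt {x t a N M ε : ℝ} (hx : |x| ≤ 1) (ha : |a| ≤ M) (hM : 0 ≤ M)
    (hN : |N - t| ≤ M) (hε : 0 < ε) (ht : M + 2 * M / ε < t) :
    |N⁻¹ * (a + t * x) - x| < ε := by
  have hNlow : 2 * M / ε < N := by linarith [(abs_le.1 hN).1]
  have hNpos : 0 < N := lt_of_le_of_lt (by positivity) hNlow
  have heq : N⁻¹ * (a + t * x) - x = (a - (N - t) * x) / N := by
    field_simp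
    ring
  rw [heq, abs_div, abs_of_pos hNpos, div_lt_iff₀ hNpos]
  calc |a - (N - t) * x| ≤ |a| + |(N - t) * x| := abs_sub _ _
    _ ≤ M + M * 1 := by
      rw [abs_mul]
      gcongr
    _ = 2 * M := by ring
    _ < ε * N := by rwa [div_lt_iff₀' hε] at hNlow

/-- The unit incident direction `(r_λ(p) − (s,0)) / ‖r_λ(p) − (s,0)‖` (Euclidean norm)
converges to `(cos β(p), sin β(p))` uniformly in `(s, p) ∈ [Lmin, Lmax]²` as `λ → ∞`. -/
theorem incident_direction_tendstoUniformly
    (Lmin Lmax αmin αmax : ℝ) (hL : Lmin < Lmax)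
    (hα0 : 0 < αmin) (hαα : αmin < αmax) (hαπ : αmax < Real.pi)
    (β : ℝ → ℝ) (hβc : ContinuousOn β (Icc Lmin Lmax))
    (hβr : ∀ p ∈ Icc Lmin Lmax, β p ∈ Icc αmin αmax)
    (u : ℝ → ℝ) (huc : ContinuousOn u (Icc Lmin Lmax))
    (hup : ∀ p ∈ Icc Lmin Lmax, 0 < u p)
    (r : ℝ → ℝ → ℝ × ℝ)
    (hr : ∀ lam p, r lam p =
      (p + lam * u p * Real.cos (β p), lam * u p * Real.sin (β p))) :
    TendstoUniformlyOn
      (fun (lam : ℝ) (sp : ℝ × ℝ) =>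
        (Real.sqrt (((r lam sp.2).1 - sp.1) ^ 2 + ((r lam sp.2).2) ^ 2))⁻¹ •
          ((r lam sp.2).1 - sp.1, (r lam sp.2).2))
      (fun sp => (Real.cos (β sp.2), Real.sin (β sp.2)))
      atTop (Icc Lmin Lmax ×ˢ Icc Lmin Lmax) := by
  obtain ⟨q, hq, hmin⟩ := isCompact_Icc.exists_isMinOn (nonempty_Icc.2 hL.le) huc
  rw [Metric.tendstoUniformlyOn_iff]
  intro ε hε
  set M := Lmax - Lmin
  have hM : 0 ≤ M := sub_nonneg.2 hL.le
  filter_upwards [eventually_gt_atTop ((M + 2 * M / ε) / u q), eventually_gt_atTop 0]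
    with lam hlam hpos
  rintro ⟨s, p⟩ ⟨hs, hp⟩
  have hd : |p - s| ≤ M := abs_sub_le_of_le_of_le hp.1 hp.2 hs.1 hs.2
  have ht : M + 2 * M / ε < lam * u p :=
    ((div_lt_iff₀ (hup q hq)).1 hlam).trans_le
      (mul_le_mul_of_nonneg_left (isMinOn_iff.1 hmin p hp) hpos.le)
  have hN := (abs_sqrt_sub_le_of_unit (d := p - s) (Real.cos_sq_add_sin_sq (β p))
    (mul_pos hpos (hup p hp)).le).trans hd
  have hcos := abs_inv_mul_sub_lt (Real.abs_cos_le_one (β p)) hd hM hN hε ht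
  have hsin := abs_inv_mul_sub_lt (a := 0) (Real.abs_sin_le_one (β p)) (by simpa using hM)
    hM hN hε ht
  rw [zero_add] at hsin
  rw [dist_comm, Prod.dist_eq, max_lt_iff, Real.dist_eq, Real.dist_eq]
  simp only [hr, Prod.smul_mk, smul_eq_mul, add_sub_right_comm]
  exact ⟨hcos, hsin⟩
end

section
/- Fix reals L_min < L_max, angles 0 < α_min < α_max < π, and let β(p) = α_max + ((α_min − α_max)/(L_max − L_min))(p − L_min), whose slope b = (α_min − α_max)/(L_max − L_min) is nonzero. Let u : [L_min, L_max] → ℝ be continuously differentiable with u(p) > 0 for all p. For λ > 0 define r_λ(p) = (p + λ·u(p)·cos β(p), λ·u(p)·sin β(p)), and let n̂_λ(p) be the unit normal obtained by normalizing ( (r_λ)_z'(p), −(r_λ)_x'(p) ), where primes denote derivatives in p. Then as λ → ∞, n̂_λ(p) converges, uniformly in p ∈ [L_min, L_max], to n̂_∞(p) = ( u'(p)·sin β(p) + u(p)·b·cos β(p), −u'(p)·cos β(p) + u(p)·b·sin β(p) ) / √(u'(p)² + u(p)²·b²), the denominator being strictly positive since u > 0 and b ≠ 0. -/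
open Real Set Filter

/-- Coordinatewise form of the Lipschitz estimate for normalization: if the vectors with norms
`N`, `M` and coordinates `x`, `y` differ by at most one, so do their directions, up to `2 / M`. -/
lemma abs_inv_mul_sub_inv_mul_le {x y N M : ℝ} (hN : 0 < N) (hM : 0 < M) (hx : |x| ≤ N)
    (hxy : |x - y| ≤ 1) (hNM : |N - M| ≤ 1) : |N⁻¹ * x - M⁻¹ * y| ≤ 2 / M := by
  have h : N⁻¹ * x - M⁻¹ * y = (x / N * (M - N) + (x - y)) / M := by
    field_simp
    ring
  have hxN : |x / N| ≤ 1 := by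
    rw [abs_div, abs_of_pos hN]
    exact (div_le_one hN).2 hx
  rw [h, abs_div, abs_of_pos hM]
  gcongr
  calc |x / N * (M - N) + (x - y)| ≤ |x / N| * |M - N| + |x - y| := by
        rw [← abs_mul]
        exact abs_add_le _ _
    _ ≤ 1 * 1 + 1 := by
        rw [abs_sub_comm M N]
        gcongr
    _ = 2 := by norm_num

/-- Moving the second coordinate by one changes the Euclidean norm by at most one. -/
lemma sqrt_sq_add_sq_add_one_sub_le (z x : ℝ) :
    |√(z ^ 2 + (x + 1) ^ 2) - √(z ^ 2 + x ^ 2)| ≤ 1 := by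
  have h1 : |x + 1| ≤ √(z ^ 2 + (x + 1) ^ 2) := Real.abs_le_sqrt (by nlinarith)
  have h2 : |x| ≤ √(z ^ 2 + x ^ 2) := Real.abs_le_sqrt (by nlinarith)
  have s1 := Real.sq_sqrt (by positivity : 0 ≤ z ^ 2 + (x + 1) ^ 2)
  have s2 := Real.sq_sqrt (by positivity : 0 ≤ z ^ 2 + x ^ 2)
  have p1 := Real.sqrt_nonneg (z ^ 2 + (x + 1) ^ 2)
  have p2 := Real.sqrt_nonneg (z ^ 2 + x ^ 2)
  rw [abs_le] at *
  constructor
  · have := abs_le_of_sq_le_sq' (a := √(z ^ 2 + x ^ 2)) (b := √(z ^ 2 + (x + 1) ^ 2) + 1)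
      (by nlinarith) (by linarith)
    linarith
  · have := abs_le_of_sq_le_sq' (a := √(z ^ 2 + (x + 1) ^ 2)) (b := √(z ^ 2 + x ^ 2) + 1)
      (by nlinarith) (by linarith)
    linarith

/-- The unit normal of the scaled reflector curve, obtained by normalizing the rotated
tangent `((r_λ)_z'(p), −(r_λ)_x'(p))` (Euclidean norm), converges uniformly in
`p ∈ [Lmin, Lmax]` as `λ → ∞` to the limiting unit normal
`(u'·sin β + u·b·cos β, −u'·cos β + u·b·sin β) / √(u'² + u²·b²)`. -/
theorem unit_normal_tendstoUniformly
    (Lmin Lmax αmin αmax b : ℝ) (hL : Lmin < Lmax)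
    (hα0 : 0 < αmin) (hαα : αmin < αmax) (hαπ : αmax < Real.pi)
    (hb : b = (αmin - αmax) / (Lmax - Lmin))
    (β : ℝ → ℝ) (hβ : ∀ p, β p = αmax + b * (p - Lmin))
    (u u' : ℝ → ℝ)
    (hu' : ∀ p ∈ Icc Lmin Lmax, HasDerivAt u (u' p) p)
    (hu'c : ContinuousOn u' (Icc Lmin Lmax))
    (hup : ∀ p ∈ Icc Lmin Lmax, 0 < u p)
    (Dx Dz : ℝ → ℝ → ℝ)
    (hDx : ∀ lam : ℝ, 0 < lam → ∀ p ∈ Icc Lmin Lmax,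
      HasDerivAt (fun q => q + lam * u q * Real.cos (β q)) (Dx lam p) p)
    (hDz : ∀ lam : ℝ, 0 < lam → ∀ p ∈ Icc Lmin Lmax,
      HasDerivAt (fun q => lam * u q * Real.sin (β q)) (Dz lam p) p) :
    TendstoUniformlyOn
      (fun (lam : ℝ) (p : ℝ) =>
        (Real.sqrt ((Dz lam p) ^ 2 + (Dx lam p) ^ 2))⁻¹ • (Dz lam p, -Dx lam p))
      (fun p =>
        (Real.sqrt ((u' p) ^ 2 + (u p) ^ 2 * b ^ 2))⁻¹ •
          (u' p * Real.sin (β p) + u p * b * Real.cos (β p),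
            -(u' p) * Real.cos (β p) + u p * b * Real.sin (β p)))
      atTop (Icc Lmin Lmax) := by
  have hb0 : b ≠ 0 := by
    rw [hb]
    exact div_ne_zero (by linarith) (by linarith)
  have hu : ContinuousOn u (Icc Lmin Lmax) := fun p hp =>
    (hu' p hp).continuousAt.continuousWithinAt
  obtain ⟨p₀, hp₀, hmin⟩ := isCompact_Icc.exists_isMinOn (nonempty_Icc.2 hL.le) hu
  have hm : 0 < u p₀ * |b| := mul_pos (hup p₀ hp₀) (abs_pos.2 hb0)
  rw [Metric.tendstoUniformlyOn_iff]
  intro ε hε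
  filter_upwards [eventually_gt_atTop (0 : ℝ), eventually_gt_atTop (1 / (u p₀ * |b|)),
    eventually_gt_atTop (2 / ε / (u p₀ * |b|))] with lam hlam hlam1 hlam2 p hp
  rw [div_lt_iff₀ hm] at hlam1 hlam2
  have hβ' : HasDerivAt β b p := by
    rw [funext hβ]
    simpa using (((hasDerivAt_id p).sub_const Lmin).const_mul b).const_add αmax
  have hz : Dz lam p = lam * (u' p * Real.sin (β p) + u p * b * Real.cos (β p)) := by
    rw [(hDz lam hlam p hp).unique (((hu' p hp).const_mul lam).mul hβ'.sin)]
    ring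
  have hx : Dx lam p = lam * (u' p * Real.cos (β p) - u p * b * Real.sin (β p)) + 1 := by
    rw [(hDx lam hlam p hp).unique
      ((hasDerivAt_id p).add (((hu' p hp).const_mul lam).mul hβ'.cos))]
    ring
  set A := u' p * Real.sin (β p) + u p * b * Real.cos (β p) with hA
  set B := u' p * Real.cos (β p) - u p * b * Real.sin (β p) with hB
  have hS : (u' p) ^ 2 + (u p) ^ 2 * b ^ 2 = A ^ 2 + B ^ 2 := by
    rw [hA, hB]
    linear_combination (-(u' p) ^ 2 - (u p) ^ 2 * b ^ 2) * Real.sin_sq_add_cos_sq (β p)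
  have hmS : u p₀ * |b| ≤ √(A ^ 2 + B ^ 2) := by
    have h : u p₀ * |b| ≤ u p * |b| := mul_le_mul_of_nonneg_right (hmin hp) (abs_nonneg b)
    refine h.trans (Real.le_sqrt_of_sq_le ?_)
    rw [← hS, mul_pow, sq_abs]
    nlinarith [sq_nonneg (u' p)]
  have hM : √((lam * A) ^ 2 + (lam * B) ^ 2) = lam * √(A ^ 2 + B ^ 2) := by
    rw [← Real.sqrt_sq hlam.le, ← Real.sqrt_mul (sq_nonneg lam), Real.sqrt_sq hlam.le]
    ring_nf
  have hmM : lam * (u p₀ * |b|) ≤ lam * √(A ^ 2 + B ^ 2) := mul_le_mul_of_nonneg_left hmS hlam.le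
  have hNM := sqrt_sq_add_sq_add_one_sub_le (lam * A) (lam * B)
  rw [hM] at hNM
  have hMpos : 0 < lam * √(A ^ 2 + B ^ 2) := by linarith
  have hNpos : 0 < √((lam * A) ^ 2 + (lam * B + 1) ^ 2) := by linarith [(abs_le.1 hNM).1]
  have hlt : 2 / (lam * √(A ^ 2 + B ^ 2)) < ε := by
    rw [div_lt_comm₀ hMpos hε]
    exact hlam2.trans_le hmM
  have hscale (y : ℝ) :
      (√(A ^ 2 + B ^ 2))⁻¹ * y = (lam * √(A ^ 2 + B ^ 2))⁻¹ * (lam * y) := by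
    field_simp
  rw [hS, hz, hx, dist_comm, Prod.dist_eq]
  refine max_lt ?_ ?_
  · simp only [Prod.smul_fst, smul_eq_mul, Real.dist_eq]
    rw [hscale]
    exact (abs_inv_mul_sub_inv_mul_le hNpos hMpos (Real.abs_le_sqrt (by nlinarith))
      (by simp) hNM).trans_lt hlt
  · simp only [Prod.smul_snd, smul_eq_mul, Real.dist_eq]
    rw [hscale, show -u' p * Real.cos (β p) + u p * b * Real.sin (β p) = -B by rw [hB]; ring]
    exact (abs_inv_mul_sub_inv_mul_le hNpos hMpos (Real.abs_le_sqrt (by nlinarith))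
      (by ring_nf; simp) hNM).trans_lt hlt
end
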